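/- arXiv:2409.14462 — 2 statements merged into one kernel-verified Lean document; each statement's English description precedes it below -/
import Mathlib

section
/- Fix integers q ≥ 2, m ≥ 2, functions h_1, …, h_{m−1}, h'_1, …, h'_{m−1}, g_1, …, g_m : ℤ_q → ℤ_q and a permutation π of {1, …, m}. Define f : ℤ_q^m → ℤ_q by f(x_1,…,x_m) = ∑_{i=1}^{m−1} h_i(x_{π(i)}) h'_i(x_{π(i+1)}) + ∑_{j=1}^m g_j(x_j), set F_{x,t} = f(x_1,…,x_m) + t·x_{π(m)}, and for t ∈ ℤ_q let ψ(C_t) be the code whose d-th sequence (d ∈ ℤ_q) has x-th entry ξ_q^{F_{x,t} + d·x_{π(1)}} for x ∈ {0, …, q^m−1} with base-q digits (x_1,…,x_m). Then for every τ with 0 < τ < q^m and all t, t' ∈ ℤ_q, Θ(ψ(C_t), ψ(C_{t'}))(τ) = q · ∑ ξ_q^{F_{x,t} − F_{y,t'}}, where the sum ranges over those x ∈ {0, …, q^m − τ − 1} such that, setting y = x + τ, the base-q digits satisfy x_{π(1)} = y_{π(1)}. -/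
open scoped Classical

/-- Aperiodic cross-correlation function (ACCF) of two length-`L` complex sequences
at integer shift `τ`:
`Θ(a,b)(τ) = ∑_{t=0}^{L−τ−1} a_t · conj(b_{t+τ})` for `0 ≤ τ`, and
`Θ(a,b)(τ) = ∑_{t=0}^{L+τ−1} a_{t−τ} · conj(b_t)` for `τ < 0`. -/
noncomputable def accf (L : ℕ) (a b : ℕ → ℂ) (τ : ℤ) : ℂ :=
  if 0 ≤ τ then
    ∑ t ∈ Finset.range (L - τ.toNat), a t * (starRingEnd ℂ) (b (t + τ.toNat))
  else
    ∑ t ∈ Finset.range (L - (-τ).toNat), a (t + (-τ).toNat) * (starRingEnd ℂ) (b t)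

/-- ACCF (sum) of two codes, i.e. tuples of length-`L` sequences indexed by `κ`:
`Θ(C, C')(τ) = ∑_m Θ(c^m, c'^m)(τ)`. -/
noncomputable def codeACCF {κ : Type*} [Fintype κ] (L : ℕ) (C C' : κ → ℕ → ℂ)
    (τ : ℤ) : ℂ :=
  ∑ m : κ, accf L (C m) (C' m) τ

/-- A family of codes `C_k` (`k : ι`), each a (`card κ`)-tuple of length-`L` sequences,
is a set of complete complementary codes (CCC) if the number of sequences per code equals
the number `K` of codes, `Θ(C_{k₁}, C_{k₂})(0) = K·L`, and all other aperiodic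
auto/cross-correlation sums with `|τ| < L` vanish. -/
noncomputable def IsCCC {ι κ : Type*} [Fintype ι] [Fintype κ] (L : ℕ)
    (C : ι → κ → ℕ → ℂ) : Prop :=
  Fintype.card κ = Fintype.card ι ∧
  ∀ k₁ k₂ : ι, ∀ τ : ℤ, |τ| < (L : ℤ) →
    codeACCF L (C k₁) (C k₂) τ =
      if τ = 0 ∧ k₁ = k₂ then ((Fintype.card ι : ℂ) * (L : ℂ)) else 0

/-- `ξ_q = exp(2πi/q)`, a primitive `q`-th root of unity. -/
noncomputable def xi (q : ℕ) : ℂ := Complex.exp (2 * Real.pi * Complex.I / q)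

/-- The `(j+1)`-st base-`q` digit `x_{j+1}` of `x` (so `x = ∑_j x_{j+1} q^j`),
regarded as an element of `ℤ_q`. -/
def dig (q x j : ℕ) : ZMod q := (((x / q ^ j) % q : ℕ) : ZMod q)

/-- The function `f(x_1,…,x_m) = ∑_{i=1}^{m−1} h_i(x_{π(i)}) h'_i(x_{π(i+1)})
+ ∑_{j=1}^m g_j(x_j)` evaluated at the base-`q` digit vector of `x ∈ {0,…,q^m−1}`.
Here indices are 0-based: `h i`, `h' i` stand for `h_{i+1}`, `h'_{i+1}`, and `π` is a
permutation of the `m` digit positions. -/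
def qfun (q m : ℕ) (hm : 2 ≤ m) (h h' : Fin (m - 1) → ZMod q → ZMod q)
    (g : Fin m → ZMod q → ZMod q) (π : Equiv.Perm (Fin m)) (x : ℕ) : ZMod q :=
  (∑ i : Fin (m - 1),
      h i (dig q x (π (Fin.castLE (by omega) i))) *
        h' i (dig q x (π (Fin.cast (by omega) i.succ)))) +
    ∑ j : Fin m, g j (dig q x j)

/-- `F_{x,t} = f(x_1,…,x_m) + t·x_{π(m)}`. -/
def Fqt (q m : ℕ) (hm : 2 ≤ m) (h h' : Fin (m - 1) → ZMod q → ZMod q)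
    (g : Fin m → ZMod q → ZMod q) (π : Equiv.Perm (Fin m)) (x : ℕ) (t : ZMod q) :
    ZMod q :=
  qfun q m hm h h' g π x + t * dig q x (π ⟨m - 1, by omega⟩)

/-- The code `ψ(C_t)`: its `d`-th sequence (`d ∈ ℤ_q`) has `x`-th entry
`ξ_q^{f(x_1,…,x_m) + d·x_{π(1)} + t·x_{π(m)}}`. -/
noncomputable def psiC (q m : ℕ) (hm : 2 ≤ m) (h h' : Fin (m - 1) → ZMod q → ZMod q)
    (g : Fin m → ZMod q → ZMod q) (π : Equiv.Perm (Fin m)) (t : ZMod q) :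
    ZMod q → ℕ → ℂ :=
  fun d x =>
    xi q ^ (Fqt q m hm h h' g π x t + d * dig q x (π ⟨0, by omega⟩)).val

/-- `ξ_q ^ a` is the value at `a` of the standard additive character of `ℤ_q`. -/
theorem xi_pow_val_eq_stdAddChar (q : ℕ) [NeZero q] (a : ZMod q) :
    xi q ^ a.val = ZMod.stdAddChar a := by
  rw [ZMod.stdAddChar_apply, ZMod.toCircle_apply, xi, ← Complex.exp_nat_mul]
  congr 1
  ring

/-- Summing `χ(A + d u) · conj χ(B + d v)` over `d ∈ ℤ_q` gives `q χ(A - B)` if `u = v`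
and zero otherwise, where `χ` is the standard additive character. -/
theorem sum_xi_pow_mul_conj (q : ℕ) [NeZero q] (A B u v : ZMod q) :
    ∑ d : ZMod q, xi q ^ (A + d * u).val * (starRingEnd ℂ) (xi q ^ (B + d * v).val) =
      if u = v then (q : ℂ) * xi q ^ (A - B).val else 0 := by
  simp only [xi_pow_val_eq_stdAddChar, ← AddChar.map_neg_eq_conj, ← AddChar.map_add_eq_mul]
  have key : ∀ d : ZMod q, (ZMod.stdAddChar (A + d * u + -(B + d * v)) : ℂ) =
      ZMod.stdAddChar (A - B) * ZMod.stdAddChar (d * (u - v)) := fun d => by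
    rw [← AddChar.map_add_eq_mul]
    congr 1
    ring
  simp only [key, ← Finset.mul_sum,
    AddChar.sum_mulShift _ (ZMod.isPrimitive_stdAddChar q), sub_eq_zero, ZMod.card]
  split_ifs
  · exact mul_comm _ _
  · simp

/-- for `0 < τ < q^m`, the ACCF of the codes `ψ(C_t)`, `ψ(C_{t'})`
equals `q·∑ ξ_q^{F_{x,t} − F_{y,t'}}`, the sum ranging over `x ∈ {0,…,q^m−τ−1}` such
that, with `y = x + τ`, the base-`q` digits satisfy `x_{π(1)} = y_{π(1)}`. -/
theorem stmt_8 (q m : ℕ) [NeZero q] (hq : 2 ≤ q) (hm : 2 ≤ m)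
    (h h' : Fin (m - 1) → ZMod q → ZMod q) (g : Fin m → ZMod q → ZMod q)
    (π : Equiv.Perm (Fin m)) (τ : ℕ) (hτ : 0 < τ) (hτ' : τ < q ^ m) (t t' : ZMod q) :
    codeACCF (q ^ m) (psiC q m hm h h' g π t) (psiC q m hm h h' g π t') (τ : ℤ) =
      (q : ℂ) *
        ∑ x ∈ (Finset.range (q ^ m - τ)).filter
            (fun x => dig q x (π ⟨0, by omega⟩) = dig q (x + τ) (π ⟨0, by omega⟩)),
          xi q ^ (Fqt q m hm h h' g π x t - Fqt q m hm h h' g π (x + τ) t').val := by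
  simp only [codeACCF, accf, psiC, Int.natCast_nonneg, if_true, Int.toNat_natCast]
  rw [Finset.sum_comm, Finset.mul_sum, Finset.sum_filter]
  exact Finset.sum_congr rfl fun x _ => sum_xi_pow_mul_conj q _ _ _ _
end

section
/- (Theorem 1) Fix integers q ≥ 2, m ≥ 2 and functions h_1, …, h_{m−1}, h'_1, …, h'_{m−1} : ℤ_q → ℤ_q. For functions g_1, …, g_m : ℤ_q → ℤ_q and a permutation π of {1, …, m}, define f : ℤ_q^m → ℤ_q by f(x_1,…,x_m) = ∑_{i=1}^{m−1} h_i(x_{π(i)}) h'_i(x_{π(i+1)}) + ∑_{j=1}^m g_j(x_j), and for t ∈ ℤ_q let ψ(C_t) be the code whose d-th sequence (d ∈ ℤ_q) has x-th entry ξ_q^{f(x_1,…,x_m) + d·x_{π(1)} + t·x_{π(m)}} for x ∈ {0, …, q^m−1} with base-q digits (x_1,…,x_m). Then the following are equivalent: (a) for every choice of g_1, …, g_m and every permutation π, the family {ψ(C_t) : t ∈ ℤ_q} is a (q, q^m)-CCC; (b) every h_i and every h'_i, 1 ≤ i ≤ m−1, is a permutation of ℤ_q. -/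
open scoped Classical

/-- A sum vanishes if its average along a family of permutations of the index type vanishes. -/
lemma sum_eq_zero_of_sum_perm_eq_zero {P C : Type*} [Fintype P] [Fintype C] [Nonempty C]
    (T : C → P ≃ P) (f : P → ℂ) (hf : ∀ p, ∑ c, f (T c p) = 0) : ∑ p, f p = 0 := by
  have key : ∑ c : C, ∑ p, f (T c p) = 0 := by
    rw [Finset.sum_comm]
    exact Finset.sum_eq_zero fun p _ => hf p
  simp only [Equiv.sum_comp (T _) f, Finset.sum_const, Finset.card_univ, nsmul_eq_mul,
    mul_eq_zero, Nat.cast_eq_zero, Fintype.card_ne_zero, false_or] at key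
  exact key

/-- The aperiodic correlation as a sum over all pairs of positions at distance `τ`. -/
lemma accf_eq_sum_sum (L : ℕ) (a b : ℕ → ℂ) (τ : ℤ) :
    accf L a b τ = ∑ x ∈ Finset.range L, ∑ y ∈ Finset.range L,
      if (y : ℤ) - x = τ then a x * (starRingEnd ℂ) (b y) else 0 := by
  unfold accf
  split_ifs with hτ
  · obtain ⟨n, rfl⟩ := Int.eq_ofNat_of_zero_le hτ
    have h1 : ∀ x ∈ Finset.range L, (∑ y ∈ Finset.range L,
        if (y : ℤ) - x = n then a x * (starRingEnd ℂ) (b y) else 0) =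
        if x + n < L then a x * (starRingEnd ℂ) (b (x + n)) else 0 := by
      intro x _
      have : ∀ y : ℕ, ((y : ℤ) - x = n) ↔ x + n = y := fun y => by omega
      simp [this]
    rw [Finset.sum_congr rfl h1, ← Finset.sum_filter]
    refine Finset.sum_congr ?_ fun _ _ => by simp
    ext x
    simp only [Int.toNat_natCast, Finset.mem_range, Finset.mem_filter]
    omega
  · obtain ⟨n, hn⟩ := Int.eq_ofNat_of_zero_le (show 0 ≤ -τ by omega)
    obtain rfl : τ = -n := by omega
    rw [Finset.sum_comm]
    have h1 : ∀ y ∈ Finset.range L, (∑ x ∈ Finset.range L,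
        if (y : ℤ) - x = -n then a x * (starRingEnd ℂ) (b y) else 0) =
        if y + n < L then a (y + n) * (starRingEnd ℂ) (b y) else 0 := by
      intro y _
      have : ∀ x : ℕ, ((y : ℤ) - x = -n) ↔ y + n = x := fun y => by omega
      simp [this]
    rw [Finset.sum_congr rfl h1, ← Finset.sum_filter]
    refine Finset.sum_congr ?_ fun _ _ => by simp
    ext x
    simp only [neg_neg, Int.toNat_natCast, Finset.mem_range, Finset.mem_filter]
    omega

/-- The natural number with a given base-`q` digit vector. -/
def ofDigitVec {q m : ℕ} (v : Fin m → ZMod q) : ℕ := ∑ j, (v j).val * q ^ (j : ℕ)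

lemma ofDigitVec_lt {q m : ℕ} [NeZero q] (v : Fin m → ZMod q) : ofDigitVec v < q ^ m := by
  cases q with
  | zero => exact absurd rfl (NeZero.ne 0)
  | succ n => exact (finFunctionFinEquiv (m := n + 1) (n := m) v).isLt

lemma sum_range_pow_eq_sum_ofDigitVec {q m : ℕ} [NeZero q] (φ : ℕ → ℂ) :
    ∑ x ∈ Finset.range (q ^ m), φ x = ∑ v : Fin m → ZMod q, φ (ofDigitVec v) := by
  cases q with
  | zero => exact absurd rfl (NeZero.ne 0)
  | succ n =>
    rw [Finset.sum_range]
    exact (Equiv.sum_comp (finFunctionFinEquiv (m := n + 1) (n := m)) fun x => φ x).symm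

lemma dig_ofDigitVec {q m : ℕ} [NeZero q] (v : Fin m → ZMod q) (j : Fin m) :
    dig q (ofDigitVec v) j = v j := by
  cases q with
  | zero => exact absurd rfl (NeZero.ne 0)
  | succ n =>
    have h1 : ofDigitVec v / (n + 1) ^ (j : ℕ) % (n + 1) = (v j).val :=
      congrArg Fin.val (congrFun
        ((finFunctionFinEquiv (m := n + 1) (n := m)).symm_apply_apply v) j)
    rw [dig, h1, ZMod.natCast_zmod_val]

lemma ofDigitVec_injective {q m : ℕ} [NeZero q] :
    Function.Injective (ofDigitVec : (Fin m → ZMod q) → ℕ) := fun v w hvw => by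
  ext j
  rw [← dig_ofDigitVec v j, hvw, dig_ofDigitVec]

lemma xi_pow_val {q : ℕ} [NeZero q] (a : ZMod q) : xi q ^ a.val = ZMod.stdAddChar a := by
  rw [ZMod.stdAddChar_apply, ZMod.toCircle_apply, xi, ← Complex.exp_nat_mul]
  congr 1
  ring

/-- The sum `∑ h_i(v_{π(i)}) h'_i(v_{π(i+1)})` evaluated at a digit vector. -/
def chainForm {q m : ℕ} (hm : 2 ≤ m) (h h' : Fin (m - 1) → ZMod q → ZMod q)
    (π : Equiv.Perm (Fin m)) (v : Fin m → ZMod q) : ZMod q :=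
  ∑ i : Fin (m - 1),
    h i (v (π (Fin.castLE (by omega) i))) * h' i (v (π (Fin.cast (by omega) i.succ)))

lemma psiC_ofDigitVec {q m : ℕ} [NeZero q] (hm : 2 ≤ m)
    (h h' : Fin (m - 1) → ZMod q → ZMod q) (g : Fin m → ZMod q → ZMod q)
    (π : Equiv.Perm (Fin m)) (t d : ZMod q) (v : Fin m → ZMod q) :
    psiC q m hm h h' g π t d (ofDigitVec v) =
      ZMod.stdAddChar (chainForm hm h h' π v + ∑ j, g j (v j) +
        t * v (π ⟨m - 1, by omega⟩) + d * v (π ⟨0, by omega⟩)) := by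
  simp only [psiC, xi_pow_val, Fqt, qfun, dig_ofDigitVec, chainForm]

/-- The exponent contributed by a pair of positions to the correlation of the codes `ψ(C_{t₁})`
and `ψ(C_{t₂})`, apart from the term depending on the sequence index `d`. -/
def phaseDiff {q m : ℕ} (hm : 2 ≤ m)
    (h h' : Fin (m - 1) → ZMod q → ZMod q) (g : Fin m → ZMod q → ZMod q)
    (π : Equiv.Perm (Fin m)) (t₁ t₂ : ZMod q)
    (p : (Fin m → ZMod q) × (Fin m → ZMod q)) : ZMod q :=
  chainForm hm h h' π p.1 - chainForm hm h h' π p.2 +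
    (∑ j, g j (p.1 j) - ∑ j, g j (p.2 j)) +
    (t₁ * p.1 (π ⟨m - 1, by omega⟩) - t₂ * p.2 (π ⟨m - 1, by omega⟩))

lemma codeACCF_psiC {q m : ℕ} [NeZero q] (hm : 2 ≤ m)
    (h h' : Fin (m - 1) → ZMod q → ZMod q) (g : Fin m → ZMod q → ZMod q)
    (π : Equiv.Perm (Fin m)) (t₁ t₂ : ZMod q) (τ : ℤ) :
    codeACCF (q ^ m) (psiC q m hm h h' g π t₁) (psiC q m hm h h' g π t₂) τ =
      q * ∑ p : (Fin m → ZMod q) × (Fin m → ZMod q),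
        if (ofDigitVec p.2 : ℤ) - ofDigitVec p.1 = τ ∧
            p.1 (π ⟨0, by omega⟩) = p.2 (π ⟨0, by omega⟩) then
          ZMod.stdAddChar (phaseDiff hm h h' g π t₁ t₂ p)
        else 0 := by
  simp only [codeACCF, accf_eq_sum_sum, sum_range_pow_eq_sum_ofDigitVec, psiC_ofDigitVec,
    ← AddChar.map_neg_eq_conj, ← AddChar.map_add_eq_mul]
  simp only [← Fintype.sum_prod_type'
    (f := fun v w : Fin m → ZMod q => if (ofDigitVec w : ℤ) - ofDigitVec v = τ then _ else _)]
  rw [Finset.sum_comm, Finset.mul_sum]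
  refine Finset.sum_congr rfl fun p _ => ?_
  by_cases hτ : (ofDigitVec p.2 : ℤ) - ofDigitVec p.1 = τ
  swap
  · simp [hτ]
  have horth := AddChar.sum_mulShift (p.1 (π ⟨0, by omega⟩) - p.2 (π ⟨0, by omega⟩))
    (ZMod.isPrimitive_stdAddChar q)
  simp only [hτ, if_true, true_and]
  rw [ZMod.card] at horth
  have hsplit : ∀ d : ZMod q, ZMod.stdAddChar (chainForm hm h h' π p.1 + ∑ j, g j (p.1 j) +
        t₁ * p.1 (π ⟨m - 1, by omega⟩) + d * p.1 (π ⟨0, by omega⟩) +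
        -(chainForm hm h h' π p.2 + ∑ j, g j (p.2 j) +
        t₂ * p.2 (π ⟨m - 1, by omega⟩) + d * p.2 (π ⟨0, by omega⟩))) =
      ZMod.stdAddChar (phaseDiff hm h h' g π t₁ t₂ p) *
        ZMod.stdAddChar (d * (p.1 (π ⟨0, by omega⟩) - p.2 (π ⟨0, by omega⟩))) := by
    intro d
    rw [← AddChar.map_add_eq_mul, phaseDiff]
    congr 1
    ring
  simp only [hsplit, ← Finset.mul_sum, horth, sub_eq_zero]
  split_ifs <;> simp [mul_comm]

/-- Translating both members of a pair of digit vectors at one position. -/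
def diagShift {q m : ℕ} (j : Fin m) (c : ZMod q) :
    (Fin m → ZMod q) × (Fin m → ZMod q) ≃ (Fin m → ZMod q) × (Fin m → ZMod q) :=
  Equiv.addRight (Pi.single j c, Pi.single j c)

lemma diagShift_fst {q m : ℕ} (j l : Fin m) (c : ZMod q)
    (p : (Fin m → ZMod q) × (Fin m → ZMod q)) :
    (diagShift j c p).1 l = if l = j then p.1 j + c else p.1 l := by
  by_cases hl : l = j
  · subst hl; simp [diagShift]
  · simp [diagShift, hl]

lemma diagShift_snd {q m : ℕ} (j l : Fin m) (c : ZMod q)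
    (p : (Fin m → ZMod q) × (Fin m → ZMod q)) :
    (diagShift j c p).2 l = if l = j then p.2 j + c else p.2 l := by
  by_cases hl : l = j
  · subst hl; simp [diagShift]
  · simp [diagShift, hl]

/-- Diagonal translation preserves which coordinates agree. -/
lemma diagShift_fst_eq_snd_iff {q m : ℕ} (j l : Fin m) (c : ZMod q)
    (p : (Fin m → ZMod q) × (Fin m → ZMod q)) :
    (diagShift j c p).1 l = (diagShift j c p).2 l ↔ p.1 l = p.2 l := by
  rw [diagShift_fst, diagShift_snd]
  split_ifs with hl
  · subst hl; simp
  · rfl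

lemma ofDigitVec_sub_diagShift {q m : ℕ} (j : Fin m) (c : ZMod q)
    (p : (Fin m → ZMod q) × (Fin m → ZMod q)) (hp : p.1 j = p.2 j) :
    (ofDigitVec (diagShift j c p).2 : ℤ) - ofDigitVec (diagShift j c p).1 =
      ofDigitVec p.2 - ofDigitVec p.1 := by
  simp only [ofDigitVec, Nat.cast_sum, ← Finset.sum_sub_distrib, diagShift_fst, diagShift_snd]
  refine Finset.sum_congr rfl fun l _ => ?_
  split_ifs with hl
  · subst hl; simp [hp]
  · rfl

lemma sum_sub_sum_diagShift {q m : ℕ} (g : Fin m → ZMod q → ZMod q) (j : Fin m) (c : ZMod q)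
    (p : (Fin m → ZMod q) × (Fin m → ZMod q)) (hp : p.1 j = p.2 j) :
    ∑ l, g l ((diagShift j c p).1 l) - ∑ l, g l ((diagShift j c p).2 l) =
      ∑ l, g l (p.1 l) - ∑ l, g l (p.2 l) := by
  simp only [← Finset.sum_sub_distrib, diagShift_fst, diagShift_snd]
  refine Finset.sum_congr rfl fun l _ => ?_
  split_ifs with hl
  · subst hl; simp [hp]
  · rfl

/-- If two pairs of digit vectors both agree internally up to position `π k`, and coincide with
each other afterwards, then their differences of chain forms differ only in the `k`-th term. -/
lemma chainForm_sub_chainForm {q m : ℕ} (hm : 2 ≤ m)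
    (h h' : Fin (m - 1) → ZMod q → ZMod q) (π : Equiv.Perm (Fin m)) (k : Fin (m - 1))
    (p p' : (Fin m → ZMod q) × (Fin m → ZMod q))
    (hp : ∀ i : Fin m, (i : ℕ) ≤ k → p.1 (π i) = p.2 (π i))
    (hp' : ∀ i : Fin m, (i : ℕ) ≤ k → p'.1 (π i) = p'.2 (π i))
    (hpp' : ∀ i : Fin m, (k : ℕ) < i → p'.1 (π i) = p.1 (π i) ∧ p'.2 (π i) = p.2 (π i)) :
    chainForm hm h h' π p'.1 - chainForm hm h h' π p'.2 =
      chainForm hm h h' π p.1 - chainForm hm h h' π p.2 +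
        (h k (p'.1 (π (Fin.castLE (by omega) k))) - h k (p.1 (π (Fin.castLE (by omega) k)))) *
          (h' k (p.1 (π (Fin.cast (by omega) k.succ))) -
            h' k (p.2 (π (Fin.cast (by omega) k.succ)))) := by
  rw [← sub_eq_iff_eq_add']
  simp only [chainForm, ← Finset.sum_sub_distrib]
  rw [Fintype.sum_eq_single k]
  · have h1 := hp (Fin.castLE (by omega) k) le_rfl
    have h2 := hp' (Fin.castLE (by omega) k) le_rfl
    have h3 := hpp' (Fin.cast (by omega) k.succ) (Nat.lt_succ_self _)
    rw [h3.1, h3.2, ← h1, ← h2]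
    ring
  · intro i hik
    rcases lt_or_gt_of_ne hik with hlt | hgt
    · have h1 := hp (Fin.castLE (by omega) i) hlt.le
      have h2 := hp (Fin.cast (by omega) i.succ) (by simpa using hlt)
      have h3 := hp' (Fin.castLE (by omega) i) hlt.le
      have h4 := hp' (Fin.cast (by omega) i.succ) (by simpa using hlt)
      simp only [h1, h2, h3, h4, sub_self]
    · have h1 := hpp' (Fin.castLE (by omega) i) hgt
      have h2 := hpp' (Fin.cast (by omega) i.succ) (Nat.lt_succ_of_lt hgt)
      rw [h1.1, h1.2, h2.1, h2.2, sub_self]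

lemma sum_stdAddChar_mul_eq_zero {q : ℕ} [NeZero q] {s : ZMod q} (hs : s ≠ 0) :
    ∑ c : ZMod q, (ZMod.stdAddChar (c * s) : ℂ) = 0 := by
  rw [AddChar.sum_mulShift s (ZMod.isPrimitive_stdAddChar q), if_neg hs, Nat.cast_zero]

lemma sum_stdAddChar_eval {q m : ℕ} [NeZero q] (s : ZMod q) (l : Fin m) :
    ∑ v : Fin m → ZMod q, (ZMod.stdAddChar (s * v l) : ℂ) = if s = 0 then (q : ℂ) ^ m else 0 := by
  split_ifs with hs
  · simp [hs, ZMod.card]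
  · refine sum_eq_zero_of_sum_perm_eq_zero (C := ZMod q)
      (fun c => Equiv.addRight (Pi.single l c)) _ fun v => ?_
    have : ∀ c : ZMod q, (ZMod.stdAddChar (s * Equiv.addRight (Pi.single l c) v l) : ℂ) =
        ZMod.stdAddChar (s * v l) * ZMod.stdAddChar (c * s) := fun c => by
      rw [← AddChar.map_add_eq_mul]
      simp only [Equiv.coe_addRight, Pi.add_apply, Pi.single_eq_same]
      congr 1
      ring
    simp only [this, ← Finset.mul_sum, sum_stdAddChar_mul_eq_zero hs, mul_zero]

lemma phaseDiff_diagShift {q m : ℕ} (hm : 2 ≤ m)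
    (h h' : Fin (m - 1) → ZMod q → ZMod q) (g : Fin m → ZMod q → ZMod q)
    (π : Equiv.Perm (Fin m)) (t₁ t₂ : ZMod q) (k : Fin (m - 1))
    (c : ZMod q) (p : (Fin m → ZMod q) × (Fin m → ZMod q))
    (hp : ∀ i : Fin m, (i : ℕ) ≤ k → p.1 (π i) = p.2 (π i)) :
    phaseDiff hm h h' g π t₁ t₂ (diagShift (π (Fin.castLE (by omega) k)) c p) =
      phaseDiff hm h h' g π t₁ t₂ p +
        (h k (p.1 (π (Fin.castLE (by omega) k)) + c) - h k (p.1 (π (Fin.castLE (by omega) k)))) *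
          (h' k (p.1 (π (Fin.cast (by omega) k.succ))) -
            h' k (p.2 (π (Fin.cast (by omega) k.succ)))) := by
  have hne : (⟨m - 1, by omega⟩ : Fin m) ≠ Fin.castLE (by omega) k := by
    simp only [ne_eq, Fin.ext_iff, Fin.val_castLE]
    omega
  have hgt : ∀ i : Fin m, (k : ℕ) < i → i ≠ Fin.castLE (by omega) k := fun i hi hik => by
    simp [hik] at hi
  rw [phaseDiff, chainForm_sub_chainForm hm h h' π k p _ hp
      (fun i hi => (diagShift_fst_eq_snd_iff _ _ _ _).2 (hp i hi))
      (fun i hi => by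
        simp only [diagShift_fst, diagShift_snd, if_neg (π.injective.ne (hgt i hi)), and_self]),
    sum_sub_sum_diagShift g _ c p (hp _ le_rfl), diagShift_fst, diagShift_fst, diagShift_snd,
    if_neg (π.injective.ne hne), if_neg (π.injective.ne hne), if_pos rfl, phaseDiff]
  ring

/-- The pairs of digit vectors that first differ at position `π (k + 1)` cancel. -/
lemma sum_first_diff_eq_zero {q m : ℕ} [NeZero q] (hm : 2 ≤ m)
    (h h' : Fin (m - 1) → ZMod q → ZMod q) (g : Fin m → ZMod q → ZMod q)
    (π : Equiv.Perm (Fin m)) (t₁ t₂ : ZMod q) (τ : ℤ) (k : Fin (m - 1))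
    (hk : Function.Bijective (h k)) (hk' : Function.Injective (h' k)) :
    ∑ p : (Fin m → ZMod q) × (Fin m → ZMod q),
      (if (ofDigitVec p.2 : ℤ) - ofDigitVec p.1 = τ ∧
          (∀ i : Fin m, (i : ℕ) ≤ k → p.1 (π i) = p.2 (π i)) ∧
          p.1 (π (Fin.cast (by omega) k.succ)) ≠ p.2 (π (Fin.cast (by omega) k.succ)) then
        (ZMod.stdAddChar (phaseDiff hm h h' g π t₁ t₂ p) : ℂ) else 0) = 0 := by
  refine sum_eq_zero_of_sum_perm_eq_zero (C := ZMod q)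
    (fun c => diagShift (π (Fin.castLE (by omega) k)) c) _ fun p => ?_
  by_cases hp : ∀ i : Fin m, (i : ℕ) ≤ k → p.1 (π i) = p.2 (π i)
  swap
  · exact Finset.sum_eq_zero fun c _ => if_neg fun hc =>
      hp fun i hi => (diagShift_fst_eq_snd_iff _ _ _ _).1 (hc.2.1 i hi)
  have hpk := hp (Fin.castLE (by omega) k) le_rfl
  simp only [ne_eq, diagShift_fst_eq_snd_iff, ofDigitVec_sub_diagShift _ _ p hpk]
  split_ifs with hc
  swap
  · simp
  have hδ : h' k (p.1 (π (Fin.cast (by omega) k.succ))) -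
      h' k (p.2 (π (Fin.cast (by omega) k.succ))) ≠ 0 :=
    sub_ne_zero.2 fun heq => hc.2.2 (hk' heq)
  have hbij : Function.Bijective fun c : ZMod q =>
      h k (p.1 (π (Fin.castLE (by omega) k)) + c) - h k (p.1 (π (Fin.castLE (by omega) k))) :=
    (Equiv.subRight _).bijective.comp (hk.comp (Equiv.addLeft _).bijective)
  simp only [phaseDiff_diagShift hm h h' g π t₁ t₂ k _ p hp, AddChar.map_add_eq_mul,
    ← Finset.mul_sum]
  rw [hbij.sum_comp fun c => (ZMod.stdAddChar (c * _) : ℂ), sum_stdAddChar_mul_eq_zero hδ,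
    mul_zero]

lemma sum_agree_eq_sum_agree_zero {q m : ℕ} [NeZero q] (hm : 2 ≤ m)
    (h h' : Fin (m - 1) → ZMod q → ZMod q) (g : Fin m → ZMod q → ZMod q)
    (π : Equiv.Perm (Fin m)) (t₁ t₂ : ZMod q) (τ : ℤ)
    (hh : ∀ i, Function.Bijective (h i) ∧ Function.Bijective (h' i)) (n : ℕ) (hn : n ≤ m - 1) :
    ∑ p : (Fin m → ZMod q) × (Fin m → ZMod q),
      (if (ofDigitVec p.2 : ℤ) - ofDigitVec p.1 = τ ∧
          (∀ i : Fin m, (i : ℕ) ≤ n → p.1 (π i) = p.2 (π i)) then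
        (ZMod.stdAddChar (phaseDiff hm h h' g π t₁ t₂ p) : ℂ) else 0) =
    ∑ p : (Fin m → ZMod q) × (Fin m → ZMod q),
      (if (ofDigitVec p.2 : ℤ) - ofDigitVec p.1 = τ ∧
          p.1 (π ⟨0, by omega⟩) = p.2 (π ⟨0, by omega⟩) then
        (ZMod.stdAddChar (phaseDiff hm h h' g π t₁ t₂ p) : ℂ) else 0) := by
  induction n with
  | zero =>
    refine Finset.sum_congr rfl fun p _ => if_congr (and_congr_right fun _ => ?_) rfl rfl
    refine ⟨fun hi => hi _ le_rfl, fun h0 i hi => ?_⟩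
    rw [show i = ⟨0, by omega⟩ from Fin.ext (by simpa using hi)]
    exact h0
  | succ n ih =>
    refine Eq.trans ?_ (ih (by omega))
    rw [eq_comm, ← sub_eq_zero, ← Finset.sum_sub_distrib]
    refine (Finset.sum_congr rfl fun p _ => ?_).trans (sum_first_diff_eq_zero hm h h' g π t₁ t₂ τ
      ⟨n, by omega⟩ (hh _).1 (hh _).2.1)
    have hiff : (∀ i : Fin m, (i : ℕ) ≤ n + 1 → p.1 (π i) = p.2 (π i)) ↔
        (∀ i : Fin m, (i : ℕ) ≤ n → p.1 (π i) = p.2 (π i)) ∧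
          p.1 (π ⟨n + 1, by omega⟩) = p.2 (π ⟨n + 1, by omega⟩) := by
      refine ⟨fun H => ⟨fun i hi => H i (by omega), H _ le_rfl⟩, fun H i hi => ?_⟩
      rcases Nat.le_succ_iff.1 hi with hi | hi
      · exact H.1 i hi
      · rw [show i = ⟨n + 1, by omega⟩ from Fin.ext hi]
        exact H.2
    have hcast : (Fin.cast (by omega) (Fin.succ (⟨n, by omega⟩ : Fin (m - 1))) : Fin m) =
        ⟨n + 1, by omega⟩ := rfl
    rw [hcast]
    simp only [hiff]
    by_cases h1 : (ofDigitVec p.2 : ℤ) - ofDigitVec p.1 = τ <;>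
    by_cases h2 : ∀ i : Fin m, (i : ℕ) ≤ n → p.1 (π i) = p.2 (π i) <;>
    by_cases h3 : p.1 (π ⟨n + 1, by omega⟩) = p.2 (π ⟨n + 1, by omega⟩) <;>
    simp [h1, h2, h3]

lemma isCCC_psiC {q m : ℕ} [NeZero q] (hm : 2 ≤ m)
    (h h' : Fin (m - 1) → ZMod q → ZMod q) (g : Fin m → ZMod q → ZMod q)
    (π : Equiv.Perm (Fin m))
    (hh : ∀ i, Function.Bijective (h i) ∧ Function.Bijective (h' i)) :
    IsCCC (q ^ m) (fun t : ZMod q => psiC q m hm h h' g π t) := by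
  refine ⟨rfl, fun t₁ t₂ τ _ => ?_⟩
  rw [codeACCF_psiC, ← sum_agree_eq_sum_agree_zero hm h h' g π t₁ t₂ τ hh (m - 1) le_rfl]
  have hterm : ∀ p : (Fin m → ZMod q) × (Fin m → ZMod q),
      (if (ofDigitVec p.2 : ℤ) - ofDigitVec p.1 = τ ∧
          (∀ i : Fin m, (i : ℕ) ≤ m - 1 → p.1 (π i) = p.2 (π i)) then
        (ZMod.stdAddChar (phaseDiff hm h h' g π t₁ t₂ p) : ℂ) else 0) =
      if p.1 = p.2 then (if τ = 0 then
        (ZMod.stdAddChar ((t₁ - t₂) * p.1 (π ⟨m - 1, by omega⟩)) : ℂ) else 0) else 0 := by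
    rintro ⟨v, w⟩
    have hall : (∀ i : Fin m, (i : ℕ) ≤ m - 1 → v (π i) = w (π i)) ↔ v = w :=
      ⟨fun H => funext fun j => by simpa using H (π.symm j) (by omega), fun H i _ => by rw [H]⟩
    simp only [hall]
    by_cases hvw : v = w
    · subst hvw
      simp [phaseDiff, sub_mul, eq_comm]
    · simp [hvw]
  simp only [hterm, Fintype.sum_prod_type, Finset.sum_ite_eq, Finset.mem_univ, if_true]
  by_cases hτ : τ = 0
  · simp only [hτ, if_true, sum_stdAddChar_eval, sub_eq_zero, true_and, ZMod.card]
    push_cast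
    split_ifs <;> simp
  · simp [hτ]

/-- The exponent sums of a map of finite cyclic groups at all nonzero frequencies detect
surjectivity. -/
lemma surjective_of_sum_stdAddChar_eq_zero {q : ℕ} [NeZero q] (f : ZMod q → ZMod q)
    (hf : ∀ δ : ZMod q, δ ≠ 0 → ∑ c, (ZMod.stdAddChar (f c * δ) : ℂ) = 0) :
    Function.Surjective f := by
  intro z
  by_contra! hz
  have h0 : ∑ δ : ZMod q, ∑ c : ZMod q, (ZMod.stdAddChar (δ * (f c - z)) : ℂ) = 0 := by
    rw [Finset.sum_comm]
    exact Finset.sum_eq_zero fun c _ => sum_stdAddChar_mul_eq_zero (sub_ne_zero.2 (hz c))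
  rw [Fintype.sum_eq_single 0] at h0
  · simp [ZMod.card, NeZero.ne q] at h0
  · intro δ hδ
    have : ∀ c, (ZMod.stdAddChar (δ * (f c - z)) : ℂ) =
        ZMod.stdAddChar (-(δ * z)) * ZMod.stdAddChar (f c * δ) := fun c => by
      rw [← AddChar.map_add_eq_mul]
      congr 1
      ring
    simp only [this, ← Finset.mul_sum, hf δ hδ, mul_zero]

lemma bijective_of_sum_stdAddChar_eq_zero {q : ℕ} [NeZero q] (f f' : ZMod q → ZMod q)
    (hf : ∀ a b : ZMod q, a.val < b.val →
      ∑ c, (ZMod.stdAddChar (f c * (f' a - f' b)) : ℂ) = 0) :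
    Function.Bijective f ∧ Function.Bijective f' := by
  have hne : ∀ a b : ZMod q, a ≠ b →
      ∑ c, (ZMod.stdAddChar (f c * (f' a - f' b)) : ℂ) = 0 := by
    intro a b hab
    rcases lt_or_gt_of_ne ((ZMod.val_injective q).ne hab) with hlt | hgt
    · exact hf a b hlt
    · have := congrArg (starRingEnd ℂ) (hf b a hgt)
      simpa only [map_sum, ← AddChar.map_neg_eq_conj, map_zero, ← mul_neg, neg_sub] using this
  have hinj : Function.Injective f' := by
    intro a b hab
    by_contra hne'
    have := hne a b hne'
    simp [hab, ZMod.card, NeZero.ne q] at this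
  have hbij := Finite.injective_iff_bijective.1 hinj
  refine ⟨Finite.surjective_iff_bijective.1
    (surjective_of_sum_stdAddChar_eq_zero f fun δ hδ => ?_), hbij⟩
  obtain ⟨b, hb⟩ := hbij.2 0
  obtain ⟨a, rfl⟩ := hbij.2 δ
  simpa [hb] using hne a b fun hab => hδ (hab ▸ hb)

/-- Orthogonality over all choices of the one-variable functions `g_j`. -/
lemma sum_stdAddChar_sum_eq {q m : ℕ} [NeZero q]
    (p p₀ : (Fin m → ZMod q) × (Fin m → ZMod q)) :
    ∑ g : Fin m → ZMod q → ZMod q,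
      (ZMod.stdAddChar (∑ j, g j (p.1 j) - ∑ j, g j (p.2 j) -
        (∑ j, g j (p₀.1 j) - ∑ j, g j (p₀.2 j))) : ℂ) =
      if ∀ (j : Fin m) (γ : ZMod q → ZMod q), γ (p.1 j) - γ (p.2 j) = γ (p₀.1 j) - γ (p₀.2 j)
      then (Fintype.card (Fin m → ZMod q → ZMod q) : ℂ) else 0 := by
  split_ifs with hγ
  · have : ∀ g : Fin m → ZMod q → ZMod q, ∑ j, g j (p.1 j) - ∑ j, g j (p.2 j) -
        (∑ j, g j (p₀.1 j) - ∑ j, g j (p₀.2 j)) = 0 := fun g => by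
      simp only [← Finset.sum_sub_distrib, hγ, sub_self]
    simp only [this, AddChar.map_zero_eq_one, Finset.sum_const, Finset.card_univ, nsmul_eq_mul,
      mul_one]
  · push Not at hγ
    obtain ⟨j, γ, hγ⟩ := hγ
    refine sum_eq_zero_of_sum_perm_eq_zero (C := ZMod q)
      (fun c => Equiv.addRight (Pi.single j fun x => c * γ x)) _ fun g => ?_
    have hs : ∀ (c : ZMod q) (v : Fin m → ZMod q),
        ∑ l, (g + Pi.single j (fun x => c * γ x) : Fin m → ZMod q → ZMod q) l (v l) = ∑ l, g l (v l) + c * γ (v j) := by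
      intro c v
      simp only [Pi.add_apply, Finset.sum_add_distrib, add_right_inj]
      rw [Fintype.sum_eq_single j fun l hl => by simp [hl], Pi.single_eq_same]
    have hsplit : ∀ c : ZMod q,
        (ZMod.stdAddChar (∑ l, g l (p.1 l) + c * γ (p.1 j) - (∑ l, g l (p.2 l) + c * γ (p.2 j)) -
          (∑ l, g l (p₀.1 l) + c * γ (p₀.1 j) - (∑ l, g l (p₀.2 l) + c * γ (p₀.2 j)))) : ℂ) =
        ZMod.stdAddChar (∑ j, g j (p.1 j) - ∑ j, g j (p.2 j) -
          (∑ j, g j (p₀.1 j) - ∑ j, g j (p₀.2 j))) *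
        ZMod.stdAddChar (c * (γ (p.1 j) - γ (p.2 j) - (γ (p₀.1 j) - γ (p₀.2 j)))) := by
      intro c
      rw [← AddChar.map_add_eq_mul]
      congr 1
      ring
    simp only [Equiv.coe_addRight, hs, hsplit, ← Finset.mul_sum,
      sum_stdAddChar_mul_eq_zero (sub_ne_zero.2 hγ), mul_zero]

/-- If formal differences of points agree, the points agree up to a swap. -/
lemma eq_or_swap_of_forall_sub_eq {q : ℕ} (hq : 2 ≤ q) {x y a b : ZMod q} (hab : a ≠ b)
    (hγ : ∀ γ : ZMod q → ZMod q, γ x - γ y = γ a - γ b) :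
    x = a ∧ y = b ∨ x = b ∧ y = a := by
  have : Fact (1 < q) := ⟨hq⟩
  have h1 := hγ fun z => if z = a then 1 else 0
  have h2 := hγ fun z => if z = b then 1 else 0
  simp only [if_true, if_neg hab, if_neg hab.symm] at h1 h2
  by_cases hx : x = a
  · subst hx
    refine Or.inl ⟨rfl, ?_⟩
    by_contra hy
    simp [hy, hab] at h2
  · by_cases hy : y = a
    · subst hy
      refine Or.inr ⟨?_, rfl⟩
      by_contra hxb
      simp [hxb, hab] at h2
    · simp [hx, hy] at h1

lemma eq_of_forall_sub_eq_zero {q : ℕ} {x y : ZMod q}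
    (hγ : ∀ γ : ZMod q → ZMod q, γ x - γ y = 0) : x = y :=
  sub_eq_zero.1 (hγ id)

/-- Averaging the correlations over all `g` isolates the pairs of digit vectors matching a given
pair `p₀`, provided `p₀` is digitwise increasing. -/
lemma forall_sub_eq_iff {q m : ℕ} [NeZero q] (hq : 2 ≤ q)
    (p p₀ : (Fin m → ZMod q) × (Fin m → ZMod q)) (hp₀ : ∀ j, (p₀.1 j).val ≤ (p₀.2 j).val) :
    ((ofDigitVec p.2 : ℤ) - ofDigitVec p.1 = ofDigitVec p₀.2 - ofDigitVec p₀.1 ∧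
      ∀ (j : Fin m) (γ : ZMod q → ZMod q), γ (p.1 j) - γ (p.2 j) = γ (p₀.1 j) - γ (p₀.2 j)) ↔
    ∀ j, if p₀.1 j = p₀.2 j then p.1 j = p.2 j else p.1 j = p₀.1 j ∧ p.2 j = p₀.2 j := by
  simp only [ofDigitVec, Nat.cast_sum, Nat.cast_mul, ← Finset.sum_sub_distrib, ← sub_mul]
  constructor
  · rintro ⟨hτ, hγ⟩
    have hcase : ∀ j, p₀.1 j ≠ p₀.2 j → (p.1 j = p₀.1 j ∧ p.2 j = p₀.2 j) ∨
        (p.1 j = p₀.2 j ∧ p.2 j = p₀.1 j) :=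
      fun j hj => eq_or_swap_of_forall_sub_eq hq hj (hγ j)
    have heq : ∀ j, p₀.1 j = p₀.2 j → p.1 j = p.2 j := fun j hj =>
      eq_of_forall_sub_eq_zero fun γ => by rw [hγ, hj, sub_self]
    have hle : ∀ j ∈ Finset.univ, (((p.2 j).val : ℤ) - (p.1 j).val) * (q ^ (j : ℕ) : ℕ) ≤
        (((p₀.2 j).val : ℤ) - (p₀.1 j).val) * (q ^ (j : ℕ) : ℕ) := by
      intro j _
      refine mul_le_mul_of_nonneg_right ?_ (Nat.cast_nonneg _)
      have := hp₀ j
      by_cases hj : p₀.1 j = p₀.2 j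
      · rw [heq j hj, hj]
        simp
      · rcases hcase j hj with ⟨h1, h2⟩ | ⟨h1, h2⟩ <;> rw [h1, h2]
        omega
    have hall := (Finset.sum_eq_sum_iff_of_le hle).1 hτ
    intro j
    split_ifs with hj
    · exact heq j hj
    · refine (hcase j hj).resolve_right fun hsw => hj ?_
      have hq0 : ((q ^ (j : ℕ) : ℕ) : ℤ) ≠ 0 := by exact_mod_cast (pow_ne_zero _ (NeZero.ne q))
      have := mul_right_cancel₀ hq0 (hall j (Finset.mem_univ j))
      rw [hsw.1, hsw.2] at this
      exact ZMod.val_injective q (by omega)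
  · intro H
    refine ⟨Finset.sum_congr rfl fun j _ => ?_, fun j γ => ?_⟩ <;>
    · have := H j
      split_ifs at this with hj
      · rw [this, hj]
        simp
      · rw [this.1, this.2]

/-- Averaging over `g` of vanishing correlations. -/
lemma sum_matching_eq_zero {q m : ℕ} [NeZero q] (hq : 2 ≤ q) (hm : 2 ≤ m)
    (h h' : Fin (m - 1) → ZMod q → ZMod q) (π : Equiv.Perm (Fin m))
    (hC : ∀ g : Fin m → ZMod q → ZMod q,
      IsCCC (q ^ m) (fun t : ZMod q => psiC q m hm h h' g π t))
    (p₀ : (Fin m → ZMod q) × (Fin m → ZMod q)) (hp₀ : ∀ j, (p₀.1 j).val ≤ (p₀.2 j).val)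
    (h0 : p₀.1 (π ⟨0, by omega⟩) = p₀.2 (π ⟨0, by omega⟩)) (hne : p₀.1 ≠ p₀.2) :
    ∑ p : (Fin m → ZMod q) × (Fin m → ZMod q),
      (if ∀ j, if p₀.1 j = p₀.2 j then p.1 j = p.2 j else p.1 j = p₀.1 j ∧ p.2 j = p₀.2 j then
        (ZMod.stdAddChar (chainForm hm h h' π p.1 - chainForm hm h h' π p.2) : ℂ) else 0) = 0 := by
  set τ : ℤ := ofDigitVec p₀.2 - ofDigitVec p₀.1 with hτdef
  have hτ0 : τ ≠ 0 := fun h0 => hne (ofDigitVec_injective (by omega))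
  have hτL : |τ| < ((q ^ m : ℕ) : ℤ) := by
    have h1 := ofDigitVec_lt p₀.1
    have h2 := ofDigitVec_lt p₀.2
    rw [abs_lt]
    constructor <;> omega
  have hq0 : (q : ℂ) ≠ 0 := Nat.cast_ne_zero.2 (NeZero.ne q)
  have hcorr : ∀ g : Fin m → ZMod q → ZMod q, ∑ p : (Fin m → ZMod q) × (Fin m → ZMod q),
      (if (ofDigitVec p.2 : ℤ) - ofDigitVec p.1 = τ ∧
          p.1 (π ⟨0, by omega⟩) = p.2 (π ⟨0, by omega⟩) then
        (ZMod.stdAddChar (phaseDiff hm h h' g π 0 0 p) : ℂ) else 0) = 0 := by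
    intro g
    have := (hC g).2 0 0 τ hτL
    rw [codeACCF_psiC, if_neg fun hh => hτ0 hh.1] at this
    exact (mul_eq_zero.1 this).resolve_left hq0
  have havg : ∑ g : Fin m → ZMod q → ZMod q,
      ZMod.stdAddChar (-(∑ j, g j (p₀.1 j) - ∑ j, g j (p₀.2 j))) *
        ∑ p : (Fin m → ZMod q) × (Fin m → ZMod q),
      (if (ofDigitVec p.2 : ℤ) - ofDigitVec p.1 = τ ∧
          p.1 (π ⟨0, by omega⟩) = p.2 (π ⟨0, by omega⟩) then
        (ZMod.stdAddChar (phaseDiff hm h h' g π 0 0 p) : ℂ) else 0) = 0 :=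
    Finset.sum_eq_zero fun g _ => by rw [hcorr g, mul_zero]
  simp only [Finset.mul_sum] at havg
  rw [Finset.sum_comm] at havg
  have hcard : (Fintype.card (Fin m → ZMod q → ZMod q) : ℂ) ≠ 0 :=
    Nat.cast_ne_zero.2 Fintype.card_ne_zero
  refine (mul_eq_zero.1 ((Finset.mul_sum _ _ _).trans (Eq.trans ?_ havg))).resolve_left hcard
  refine Finset.sum_congr rfl fun p _ => ?_
  have hsplit : ∀ g : Fin m → ZMod q → ZMod q,
      (ZMod.stdAddChar (-(∑ j, g j (p₀.1 j) - ∑ j, g j (p₀.2 j))) : ℂ) *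
        ZMod.stdAddChar (phaseDiff hm h h' g π 0 0 p) =
      ZMod.stdAddChar (chainForm hm h h' π p.1 - chainForm hm h h' π p.2) *
        ZMod.stdAddChar (∑ j, g j (p.1 j) - ∑ j, g j (p.2 j) -
        (∑ j, g j (p₀.1 j) - ∑ j, g j (p₀.2 j))) := by
    intro g
    rw [← AddChar.map_add_eq_mul, ← AddChar.map_add_eq_mul, phaseDiff]
    congr 1
    ring
  have hiff := forall_sub_eq_iff hq p p₀ hp₀
  rw [← hτdef] at hiff
  rw [if_congr hiff.symm rfl rfl]
  by_cases hc : (ofDigitVec p.2 : ℤ) - ofDigitVec p.1 = τ ∧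
      p.1 (π ⟨0, by omega⟩) = p.2 (π ⟨0, by omega⟩)
  · simp only [if_pos hc, hsplit, ← Finset.mul_sum, sum_stdAddChar_sum_eq]
    simp only [hc.1, true_and]
    split_ifs <;> simp [mul_comm]
  · have : ¬((ofDigitVec p.2 : ℤ) - ofDigitVec p.1 = τ ∧ ∀ (j : Fin m) (γ : ZMod q → ZMod q),
        γ (p.1 j) - γ (p.2 j) = γ (p₀.1 j) - γ (p₀.2 j)) := fun hh =>
      hc ⟨hh.1, eq_of_forall_sub_eq_zero fun γ => by rw [hh.2, h0, sub_self]⟩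
    simp [if_neg hc, if_neg this]

/-- The pair of digit vectors that agrees up to position `i`, carries `(a, b)` at position
`i + 1`, and `(0, 1)` afterwards. -/
def testPair {q m : ℕ} (i : ℕ) (a b : ZMod q) : (Fin m → ZMod q) × (Fin m → ZMod q) :=
  (fun j => if (j : ℕ) = i + 1 then a else 0,
    fun j => if (j : ℕ) = i + 1 then b else if (j : ℕ) ≤ i then 0 else 1)

lemma testPair_fst_eq_snd_iff {q m : ℕ} (hq : 2 ≤ q) (i : ℕ) {a b : ZMod q} (hab : a ≠ b)
    (j : Fin m) : (testPair i a b).1 j = (testPair (m := m) i a b).2 j ↔ (j : ℕ) ≤ i := by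
  have : Fact (1 < q) := ⟨hq⟩
  simp only [testPair]
  split_ifs with h1 h2
  · simp only [hab, false_iff]
    omega
  · simpa using h2
  · simpa using h2

lemma sum_stdAddChar_eq_zero_of_isCCC {q m : ℕ} [NeZero q] (hq : 2 ≤ q) (hm : 2 ≤ m)
    (h h' : Fin (m - 1) → ZMod q → ZMod q)
    (hC : ∀ g : Fin m → ZMod q → ZMod q,
      IsCCC (q ^ m) (fun t : ZMod q => psiC q m hm h h' g 1 t))
    (i : Fin (m - 1)) (a b : ZMod q) (hab : a.val < b.val) :
    ∑ c, (ZMod.stdAddChar (h i c * (h' i a - h' i b)) : ℂ) = 0 := by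
  have hab' : a ≠ b := fun hh => by simp [hh] at hab
  have hsum := sum_matching_eq_zero hq hm h h' 1 hC (testPair i a b)
    (fun j => by
      simp only [testPair]
      split_ifs
      · exact hab.le
      · simp
      · simp)
    ((testPair_fst_eq_snd_iff hq i hab' _).2 (Nat.zero_le _))
    (fun heq => by
      have := (testPair_fst_eq_snd_iff hq i hab' (⟨i + 1, by omega⟩ : Fin m)).1 (congrFun heq _)
      simp at this)
  simp only [testPair_fst_eq_snd_iff hq i hab'] at hsum
  set S := ∑ c, (ZMod.stdAddChar (h i c * (h' i a - h' i b)) : ℂ) with hS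
  set e : Fin m := Fin.castLE (by omega) i with he
  set Q : (Fin m → ZMod q) × (Fin m → ZMod q) → Prop := fun p =>
    ∀ j : Fin m, if (j : ℕ) ≤ i then p.1 j = p.2 j else
      p.1 j = (testPair i a b).1 j ∧ p.2 j = (testPair (m := m) i a b).2 j with hQ
  have hQT : ∀ c p, Q (diagShift e c p) ↔ Q p := fun c p => by
    refine forall_congr' fun j => ?_
    split_ifs with hj
    · exact diagShift_fst_eq_snd_iff _ _ _ _
    · have hje : j ≠ e := fun hje => hj (by simp [hje, he])
      rw [diagShift_fst, diagShift_snd, if_neg hje, if_neg hje]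
  set D : ZMod q := chainForm hm h h' 1 (testPair i a b).1 -
    chainForm hm h h' 1 (testPair i a b).2 - h i ((testPair i a b).1 e) * (h' i a - h' i b) with hD
  have hphase : ∀ p, Q p → (ZMod.stdAddChar (chainForm hm h h' 1 p.1 -
      chainForm hm h h' 1 p.2) : ℂ) =
      ZMod.stdAddChar D * ZMod.stdAddChar (h i (p.1 e) * (h' i a - h' i b)) := fun p hp => by
    rw [← AddChar.map_add_eq_mul, chainForm_sub_chainForm hm h h' 1 i (testPair i a b) p
      (fun j hj => (testPair_fst_eq_snd_iff hq i hab' j).2 hj)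
      (fun j hj => by simpa [hj] using hp j)
      (fun j hj => by simpa [not_le.2 hj] using hp j), hD]
    congr 1
    simp only [Equiv.Perm.one_apply, ← he]
    have h1 : (testPair i a b).1 (Fin.cast (by omega) i.succ : Fin m) = a := by simp [testPair]
    have h2 : (testPair i a b).2 (Fin.cast (by omega) i.succ : Fin m) = b := by simp [testPair]
    rw [h1, h2]
    ring
  have hq0 : (q : ℂ) ≠ 0 := Nat.cast_ne_zero.2 (NeZero.ne q)
  have havg : ∑ p, ((if Q p then (ZMod.stdAddChar (chainForm hm h h' 1 p.1 -
      chainForm hm h h' 1 p.2) : ℂ) else 0) -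
      if Q p then ZMod.stdAddChar D * S / q else 0) = 0 := by
    refine sum_eq_zero_of_sum_perm_eq_zero (C := ZMod q) (diagShift e) _ fun p => ?_
    by_cases hp : Q p
    · simp only [hQT, hp, if_true, hphase _ ((hQT _ p).2 hp), diagShift_fst,
        Finset.sum_sub_distrib, ← Finset.mul_sum, Finset.sum_const, Finset.card_univ, ZMod.card,
        nsmul_eq_mul]
      have hshift : ∑ c, (ZMod.stdAddChar (h i (p.1 e + c) * (h' i a - h' i b)) : ℂ) = S :=
        Equiv.sum_comp (Equiv.addLeft (p.1 e))
          fun c => (ZMod.stdAddChar (h i c * (h' i a - h' i b)) : ℂ)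
      rw [hshift]
      field_simp
      ring
    · simp [hQT, hp]
  rw [Finset.sum_sub_distrib, hsum, zero_sub, neg_eq_zero, ← Finset.sum_filter,
    Finset.sum_const, nsmul_eq_mul] at havg
  have hcard : ((Finset.univ.filter Q).card : ℂ) ≠ 0 := by
    refine Nat.cast_ne_zero.2 (Finset.card_ne_zero_of_mem (a := testPair i a b) ?_)
    refine Finset.mem_filter.2 ⟨Finset.mem_univ _, fun j => ?_⟩
    split_ifs with hj
    · exact (testPair_fst_eq_snd_iff hq i hab' j).2 hj
    · exact ⟨rfl, rfl⟩
  have hD0 : (ZMod.stdAddChar D : ℂ) ≠ 0 := by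
    rw [ZMod.stdAddChar_apply]
    exact Circle.coe_ne_zero _
  simpa [hcard, hD0, hq0] using havg

/-- Theorem 1: with `h_i, h'_i` fixed, the family
`{ψ(C_t) : t ∈ ℤ_q}` is a `(q, q^m)`-CCC for every choice of the `g_j` and every
permutation `π` iff every `h_i` and every `h'_i` is a permutation of `ℤ_q`. -/
theorem stmt_9 (q m : ℕ) [NeZero q] (hq : 2 ≤ q) (hm : 2 ≤ m)
    (h h' : Fin (m - 1) → ZMod q → ZMod q) :
    (∀ (g : Fin m → ZMod q → ZMod q) (π : Equiv.Perm (Fin m)),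
        IsCCC (q ^ m) (fun t : ZMod q => psiC q m hm h h' g π t)) ↔
      ∀ i : Fin (m - 1), Function.Bijective (h i) ∧ Function.Bijective (h' i) := by
  refine ⟨fun hC i => ?_, fun hh g π => isCCC_psiC hm h h' g π hh⟩
  exact bijective_of_sum_stdAddChar_eq_zero _ _ fun a b hab =>
    sum_stdAddChar_eq_zero_of_isCCC hq hm h h' (fun g => hC g 1) i a b hab
end
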